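/- For every real number x ≥ 2, the prime counting function satisfies π(x) ≤ (1 + (log 2)/2) · x / log x. -/

import Mathlib

/-- The prime counting function `π(x)`: the number of primes `p ≤ x`. -/
noncomputable def primePi (x : ℝ) : ℕ :=
  (Finset.filter Nat.Prime (Finset.range (⌊x⌋₊ + 1))).card

open Finset in
theorem aux_log_factorial (M N : ℕ) (h : N ≤ M) :
    Real.log (N.factorial : ℝ) =
      ∑ d ∈ Finset.Icc 1 M, ArithmeticFunction.vonMangoldt d * ((N / d : ℕ) : ℝ) := by
  induction N with
  | zero => simp
  | succ N ih =>
    rw [Nat.factorial_succ, Nat.cast_mul, Real.log_mul (by positivity) (by positivity),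
      ih (by omega), ← ArithmeticFunction.vonMangoldt_sum]
    have h1 : (N + 1).divisors = (Finset.Icc 1 M).filter (fun d => d ∣ N + 1) := by
      ext d
      simp only [Nat.mem_divisors, Finset.mem_filter, Finset.mem_Icc]
      constructor
      · rintro ⟨h1, h2⟩
        exact ⟨⟨Nat.pos_of_dvd_of_pos h1 (by omega), (Nat.le_of_dvd (by omega) h1).trans h⟩, h1⟩
      · rintro ⟨_, h1⟩
        exact ⟨h1, by omega⟩
    rw [h1, Finset.sum_filter, ← Finset.sum_add_distrib]
    refine Finset.sum_congr rfl fun d _ => ?_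
    rw [Nat.succ_div]
    split_ifs <;> push_cast <;> ring

theorem aux_theta_step (N : ℕ) :
    Chebyshev.theta (N : ℝ) ≤ Chebyshev.theta ((N / 6 : ℕ) : ℝ) +
      (Real.log (N.factorial : ℝ) - Real.log ((N / 2).factorial : ℝ)
        - Real.log ((N / 3).factorial : ℝ) - Real.log ((N / 5).factorial : ℝ)
        + Real.log ((N / 30).factorial : ℝ)) := by
  rw [aux_log_factorial N N le_rfl, aux_log_factorial N (N / 2) (Nat.div_le_self _ _),
    aux_log_factorial N (N / 3) (Nat.div_le_self _ _),
    aux_log_factorial N (N / 5) (Nat.div_le_self _ _),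
    aux_log_factorial N (N / 30) (Nat.div_le_self _ _),
    ← Finset.sum_sub_distrib, ← Finset.sum_sub_distrib, ← Finset.sum_sub_distrib,
    ← Finset.sum_add_distrib]
  have hN : Chebyshev.theta (N : ℝ) =
      ∑ d ∈ Finset.Icc 1 N, if d.Prime then Real.log d else 0 := by
    rw [Chebyshev.theta, Nat.floor_natCast, Finset.sum_filter]
    rfl
  have h6 : Chebyshev.theta ((N / 6 : ℕ) : ℝ) =
      ∑ d ∈ Finset.Icc 1 N, if d ≤ N / 6 then (if d.Prime then Real.log d else 0) else 0 := by
    rw [Chebyshev.theta, Nat.floor_natCast, ← Finset.sum_filter, ← Finset.sum_filter,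
      Finset.filter_filter]
    refine Finset.sum_congr ?_ fun _ _ => rfl
    ext d
    simp only [Finset.mem_Ioc, Finset.mem_filter, Finset.mem_Icc]
    have := Nat.div_le_self N 6
    constructor
    · rintro ⟨⟨h1, h2⟩, h3⟩
      exact ⟨⟨by omega, by omega⟩, h2, h3⟩
    · rintro ⟨⟨h1, h2⟩, h3, h4⟩
      exact ⟨⟨by omega, h3⟩, h4⟩
  rw [hN, h6, ← Finset.sum_add_distrib]
  refine Finset.sum_le_sum fun d hd => ?_
  rw [Finset.mem_Icc] at hd
  have e : ∀ k, N / k / d = N / d / k := fun k => by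
    rw [Nat.div_div_eq_div_mul, Nat.div_div_eq_div_mul, Nat.mul_comm]
  rw [e, e, e, e]
  have hd1 : 1 ≤ N / d := (Nat.one_le_div_iff (by omega)).2 hd.2
  have hd6 : ¬ d ≤ N / 6 → N / d ≤ 5 := by
    intro h
    have : N / d < 6 := by
      rw [Nat.div_lt_iff_lt_mul (by omega)]
      omega
    omega
  generalize N / d = y at *
  have g0 : (0 : ℝ) ≤ (y : ℝ) - (y / 2 : ℕ) - (y / 3 : ℕ) - (y / 5 : ℕ) + (y / 30 : ℕ) := by
    have : y / 2 + y / 3 + y / 5 ≤ y + y / 30 := by omega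
    have : ((y / 2 : ℕ) : ℝ) + (y / 3 : ℕ) + (y / 5 : ℕ) ≤ y + (y / 30 : ℕ) := by
      exact_mod_cast this
    linarith
  have g1 : y ≤ 5 → (1 : ℝ) ≤ (y : ℝ) - (y / 2 : ℕ) - (y / 3 : ℕ) - (y / 5 : ℕ) + (y / 30 : ℕ) := by
    intro h
    have : y / 2 + y / 3 + y / 5 + 1 ≤ y + y / 30 := by omega
    have : ((y / 2 : ℕ) : ℝ) + (y / 3 : ℕ) + (y / 5 : ℕ) + 1 ≤ y + (y / 30 : ℕ) := by
      exact_mod_cast this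
    linarith
  have hL : (0 : ℝ) ≤ ArithmeticFunction.vonMangoldt d := ArithmeticFunction.vonMangoldt_nonneg
  have hb : (if d.Prime then Real.log d else 0) ≤ ArithmeticFunction.vonMangoldt d := by
    split_ifs with hp
    · rw [ArithmeticFunction.vonMangoldt_apply_prime hp]
    · exact hL
  have key := mul_nonneg hL g0
  by_cases h : d ≤ N / 6
  · rw [if_pos h]
    linarith
  · rw [if_neg h]
    have := mul_le_mul_of_nonneg_left (g1 (hd6 h)) hL
    linarith

/-- Increment bound for the logarithm. -/
theorem aux_log_sub_le {a b : ℝ} (ha : 0 < a) (hb : 0 < b) :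
    a * (Real.log b - Real.log a) ≤ b - a := by
  rw [← Real.log_div hb.ne' ha.ne']
  have := Real.log_le_sub_one_of_pos (div_pos hb ha)
  calc a * Real.log (b / a) ≤ a * (b / a - 1) := by gcongr
    _ = b - a := by field_simp

theorem aux_stirling (n : ℕ) :
    ((n + 1 : ℕ) : ℝ) * Real.log (n + 1 : ℕ) - (n + 1 : ℕ) + 1 ≤ Real.log ((n + 1).factorial : ℝ) ∧
    Real.log ((n + 1).factorial : ℝ) ≤
      ((n + 1 : ℕ) : ℝ) * Real.log (n + 1 : ℕ) - (n + 1 : ℕ) + 1 + Real.log (n + 1 : ℕ) := by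
  induction n with
  | zero => simp
  | succ n ih =>
    have e : Real.log ((n + 1 + 1).factorial : ℝ) =
        Real.log (n + 1 + 1 : ℕ) + Real.log ((n + 1).factorial : ℝ) := by
      rw [Nat.factorial_succ (n + 1), Nat.cast_mul, Real.log_mul (by positivity) (by positivity)]
    rw [e]
    have h1 := aux_log_sub_le (a := ((n + 1 : ℕ) : ℝ)) (b := ((n + 1 + 1 : ℕ) : ℝ))
      (by positivity) (by positivity)
    have h2 := aux_log_sub_le (b := ((n + 1 : ℕ) : ℝ)) (a := ((n + 1 + 1 : ℕ) : ℝ))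
      (by positivity) (by positivity)
    have e2 : ((n + 1 + 1 : ℕ) : ℝ) = ((n + 1 : ℕ) : ℝ) + 1 := by push_cast; ring
    generalize Real.log ((n + 1 + 1 : ℕ) : ℝ) = u at *
    generalize Real.log ((n + 1 : ℕ) : ℝ) = v at *
    rw [e2] at *
    generalize ((n + 1 : ℕ) : ℝ) = w at *
    obtain ⟨i1, i2⟩ := ih
    constructor <;> nlinarith

theorem aux_fact_upper (N k : ℕ) (hk : 0 < k) (h : k ≤ N) :
    Real.log ((N / k).factorial : ℝ) ≤
      (N / k : ℝ) * Real.log (N / k : ℝ) - N / k + 1 + Real.log (N / k : ℝ) := by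
  have hM : 1 ≤ N / k := (Nat.one_le_div_iff hk).2 h
  have h1 : ((N / k : ℕ) : ℝ) ≤ (N : ℝ) / k := Nat.cast_div_le
  obtain ⟨m, hm⟩ : ∃ m, N / k = m + 1 := ⟨N / k - 1, by omega⟩
  have h2 := (aux_stirling m).2
  rw [← hm] at h2
  have hM1 : (1 : ℝ) ≤ ((N / k : ℕ) : ℝ) := by exact_mod_cast hM
  generalize (N : ℝ) / k = y at *
  generalize ((N / k : ℕ) : ℝ) = M at *
  have hlog : Real.log M ≤ Real.log y := Real.log_le_log (by linarith) h1
  have hlog0 : 0 ≤ Real.log M := Real.log_nonneg hM1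
  have h3 := aux_log_sub_le (a := y) (b := M) (by linarith) (by linarith)
  have h4 : M * Real.log M - M ≤ y * Real.log y - y := by nlinarith
  linarith

theorem aux_fact_lower (N k : ℕ) (hk : 0 < k) (h : k ≤ N) :
    (N / k : ℝ) * Real.log (N / k : ℝ) - N / k + 1 - Real.log (N / k : ℝ) ≤
      Real.log ((N / k).factorial : ℝ) := by
  have hM : 1 ≤ N / k := (Nat.one_le_div_iff hk).2 h
  have h1 : ((N / k : ℕ) : ℝ) ≤ (N : ℝ) / k := Nat.cast_div_le
  have h1' : (N : ℝ) / k ≤ ((N / k : ℕ) : ℝ) + 1 := by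
    rw [div_le_iff₀ (by exact_mod_cast hk)]
    have := Nat.lt_div_mul_add (a := N) hk
    have : N ≤ (N / k + 1) * k := by nlinarith
    exact_mod_cast this
  obtain ⟨m, hm⟩ : ∃ m, N / k = m + 1 := ⟨N / k - 1, by omega⟩
  have h2 := (aux_stirling m).1
  rw [← hm] at h2
  have hM1 : (1 : ℝ) ≤ ((N / k : ℕ) : ℝ) := by exact_mod_cast hM
  generalize (N : ℝ) / k = y at *
  generalize ((N / k : ℕ) : ℝ) = M at *
  have hlog : Real.log M ≤ Real.log y := Real.log_le_log (by linarith) h1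
  have hlog0 : 0 ≤ Real.log M := Real.log_nonneg hM1
  have h3 := aux_log_sub_le (a := M) (b := y) (by linarith) (by linarith)
  nlinarith

/-- Numerical upper bound for logarithms through powers of `e`. -/
theorem aux_log_le {q : ℝ} (a b : ℕ) (hq : 0 < q) (hb : 0 < b) (h : q ^ b ≤ 2.7182818283 ^ a) :
    Real.log q ≤ a / b := by
  rw [le_div_iff₀ (by exact_mod_cast hb), mul_comm, ← Real.log_pow,
    Real.log_le_iff_le_exp (by positivity)]
  calc q ^ b ≤ 2.7182818283 ^ a := h
    _ ≤ (Real.exp 1) ^ a := by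
      gcongr
      exact Real.exp_one_gt_d9.le
    _ = Real.exp a := by rw [← Real.exp_nat_mul, mul_one]

theorem aux_le_log {q : ℝ} (a b : ℕ) (hq : 0 < q) (hb : 0 < b) (h : 2.7182818286 ^ a ≤ q ^ b) :
    (a : ℝ) / b ≤ Real.log q := by
  rw [div_le_iff₀ (by exact_mod_cast hb), mul_comm, ← Real.log_pow,
    Real.le_log_iff_exp_le (by positivity)]
  calc Real.exp a = (Real.exp 1) ^ a := by rw [← Real.exp_nat_mul, mul_one]
    _ ≤ 2.7182818286 ^ a := by
      gcongr
      exact Real.exp_one_lt_d9.le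
    _ ≤ q ^ b := h

theorem aux_theta_rec (N : ℕ) (hN : 30 ≤ N) :
    Chebyshev.theta (N : ℝ) ≤ Chebyshev.theta ((N / 6 : ℕ) : ℝ) +
      0.925 * N + 5 * Real.log N - 7 := by
  have h0 := aux_theta_step N
  have h1 := aux_fact_upper N 1 (by norm_num) (by omega)
  have h30 := aux_fact_upper N 30 (by norm_num) (by omega)
  have h2 := aux_fact_lower N 2 (by norm_num) (by omega)
  have h3 := aux_fact_lower N 3 (by norm_num) (by omega)
  have h5 := aux_fact_lower N 5 (by norm_num) (by omega)
  have hNpos : (0 : ℝ) < N := by exact_mod_cast (by omega : 0 < N)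
  rw [Nat.div_one] at h1
  push_cast at h1 h2 h3 h5 h30
  rw [div_one] at h1
  rw [Real.log_div hNpos.ne' (by norm_num)] at h2 h3 h5 h30
  have e30 : Real.log 30 = Real.log 2 + Real.log 3 + Real.log 5 := by
    rw [← Real.log_mul (by norm_num) (by norm_num), ← Real.log_mul (by norm_num) (by norm_num)]
    norm_num
  have eA : 14 * Real.log 2 + 9 * Real.log 3 + 5 * Real.log 5 ≤ 27.75 := by
    have := aux_log_le (q := 2 ^ 14 * 3 ^ 9 * 5 ^ 5) 111 4 (by norm_num) (by norm_num) (by norm_num)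
    rw [Real.log_mul (by norm_num) (by norm_num), Real.log_mul (by norm_num) (by norm_num),
      Real.log_pow, Real.log_pow, Real.log_pow] at this
    push_cast at this
    linarith
  have e3 : 3 ≤ Real.log 30 := by
    have := aux_le_log (q := 30) 3 1 (by norm_num) (by norm_num) (by norm_num)
    simpa using this
  have hA := mul_le_mul_of_nonneg_left eA hNpos.le
  generalize Real.log N = L at *
  rw [e30] at *
  nlinarith

theorem aux_theta_nat (N : ℕ) : Chebyshev.theta (N : ℝ) ≤ 1.15 * N + 240 := by
  induction N using Nat.strong_induction_on with
  | _ N ih =>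
    by_cases h : N < 1000
    · have h1 := Chebyshev.theta_le_log4_mul_x (x := (N : ℝ)) (by positivity)
      have h2 : Real.log 4 ≤ 1.39 := by
        have := aux_log_le (q := 4) 139 100 (by norm_num) (by norm_num) (by norm_num)
        norm_num at this ⊢
        linarith
      have h3 : (N : ℝ) ≤ 1000 := by exact_mod_cast h.le
      have h4 : (0 : ℝ) ≤ N := by positivity
      nlinarith
    · have h1 := aux_theta_rec N (by omega)
      have h2 := ih (N / 6) (by omega)
      have h3 : ((N / 6 : ℕ) : ℝ) ≤ (N : ℝ) / 6 := by exact_mod_cast Nat.cast_div_le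
      have h4 : (1000 : ℝ) ≤ N := by exact_mod_cast (by omega : 1000 ≤ N)
      have h5 := aux_log_sub_le (a := 1000) (b := (N : ℝ)) (by norm_num) (by linarith)
      have h6 : Real.log 1000 ≤ 7 := by
        have := aux_log_le (q := 1000) 7 1 (by norm_num) (by norm_num) (by norm_num)
        simpa using this
      linarith

theorem aux_theta (x : ℝ) (hx : 0 ≤ x) : Chebyshev.theta x ≤ 1.15 * x + 240 := by
  rw [Chebyshev.theta_eq_theta_coe_floor]
  have := aux_theta_nat ⌊x⌋₊
  have := Nat.floor_le hx
  linarith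

/-- The primes below `200`. -/
def auxSmall : List ℕ := [
  2, 3, 5, 7, 11, 13, 17, 19, 23, 29, 31, 37, 41, 43, 47, 53, 59, 61, 67, 71, 73, 79, 83, 89, 97,
  101, 103, 107, 109, 113, 127, 131, 137, 139, 149, 151, 157, 163, 167, 173, 179, 181, 191, 193,
  197, 199]

/-- The product of the primes below `200`. -/
def auxProd : ℕ := 7799922041683461553249199106329813876687996789903550945093032474868511536164700810

/-- A necessary condition for primality. -/
def auxTest (n : ℕ) : Bool :=
  (Nat.ble n 13 && (n == 2 || n == 3 || n == 5 || n == 7 || n == 11 || n == 13)) ||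
    (Nat.gcd n 30030 == 1 && (Nat.ble n 199 || Nat.gcd n auxProd == 1))

/-- Counts the elements of `[a, b)` that pass the test. -/
def auxCount : ℕ → ℕ → ℕ → ℕ
  | 0, a, b => b - a
  | k + 1, a, b =>
    bif Nat.ble b a then 0
    else bif Nat.ble b (a + 1) then (bif auxTest a then 1 else 0)
    else auxCount k a ((a + b) / 2) + auxCount k ((a + b) / 2) b

/-- The checker: `(a, m, l)` means that there are at most `m` primes below `a` and
`log a ≤ l / 10^6`. -/
def auxCheck : ℕ × ℕ × ℕ → List (ℕ × ℕ × ℕ) → Bool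
  | _, [] => true
  | (a, m, l), (a', m', l') :: t =>
    Nat.ble (m + auxCount 20 a a') m' && Nat.ble (a + 1) a' &&
    Nat.ble (l * (2 * a * a') + 1000000 * (a' * a' - a * a)) (l' * (2 * a * a')) &&
    Nat.ble (m' * l) (1346000 * a) && Nat.ble m' a && auxCheck (a', m', l') t

/-- The certificate for `2 ≤ x < 40000`. -/
def auxCert : List (ℕ × ℕ × ℕ) := [
  (3, 1, 1109815), (4, 2, 1401482), (5, 2, 1626482), (6, 3, 1809816), (7, 3, 1964578), (9, 4,
  2218547), (11, 4, 2420568), (13, 5, 2588401), (15, 6, 2731991), (18, 7, 2915325), (21, 8,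
  3070087), (25, 9, 3245326), (29, 9, 3394292), (34, 11, 3554029), (40, 12, 3717265), (47, 14,
  3879234), (55, 16, 4037068), (64, 18, 4189199), (73, 20, 4321156), (83, 22, 4449891), (96, 24,
  4595913), (109, 28, 4723255), (126, 30, 4868697), (145, 34, 5009612), (167, 38, 5151343), (193,
  43, 5296545), (222, 47, 5436990), (256, 54, 5579973), (293, 61, 5715379), (337, 67, 5855747),
  (388, 76, 5997137), (447, 86, 6139164), (515, 97, 6281247), (593, 107, 6422743), (682, 123,
  6563035), (785, 137, 6704154), (903, 154, 6844651), (1039, 174, 6985404), (1195, 196, 7125749),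
  (1375, 220, 7266518), (1582, 249, 7407215), (1820, 280, 7547821), (2094, 316, 7688521), (2409,
  357, 7829116), (2771, 403, 7969571), (3187, 450, 8109900), (3666, 511, 8250380), (4216, 576,
  8390622), (4849, 650, 8530965), (5577, 736, 8671301), (6414, 834, 8811590), (7377, 938,
  8951931), (8484, 1059, 9092202), (9757, 1203, 9232461), (11221, 1357, 9372719), (12905, 1535,
  9513003), (14841, 1738, 9653238), (17068, 1968, 9793506), (19629, 2225, 9933765), (22574, 2524,
  10074012), (25961, 2856, 10214265), (29856, 3233, 10354512), (34335, 3669, 10494748), (39486,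
  4154, 10634985), (40000, 4203, 10647919)]

theorem aux_cert_ok : auxCheck (2, 0, 693148) auxCert = true := by decide +kernel

theorem aux_not_dvd_prod {n b : ℕ} (hn : n.Prime) (l : List ℕ) (hl : ∀ q ∈ l, 0 < q ∧ q ≤ b)
    (hb : b < n) : Nat.gcd n l.prod = 1 := by
  rw [← Nat.coprime_iff_gcd_eq_one, hn.coprime_iff_not_dvd]
  intro h
  obtain ⟨q, hq, hd⟩ := (Nat.Prime.prime hn).dvd_prod_iff.1 h
  have h1 := hl q hq
  have := Nat.le_of_dvd h1.1 hd
  omega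

theorem aux_test_of_prime {n : ℕ} (hn : n.Prime) : auxTest n = true := by
  unfold auxTest
  by_cases h : n ≤ 13
  · interval_cases n <;> first | decide | (exact absurd hn (by norm_num))
  · have h1 : Nat.gcd n 30030 = 1 := by
      have := aux_not_dvd_prod hn [2, 3, 5, 7, 11, 13] (b := 13) (by decide) (by omega)
      simpa using this
    by_cases h2 : n ≤ 199
    · simp [h1, h2]
    · have h3 : Nat.gcd n auxProd = 1 := by
        have := aux_not_dvd_prod hn auxSmall (b := 199) (by decide) (by omega)
        have e : auxSmall.prod = auxProd := by decide +kernel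
        rwa [e] at this
      simp [h1, h3]

theorem aux_count_le (k a b : ℕ) :
    ((Finset.Ico a b).filter Nat.Prime).card ≤ auxCount k a b := by
  induction k generalizing a b with
  | zero =>
    exact (Finset.card_filter_le _ _).trans (by simp [auxCount])
  | succ k ih =>
    rw [auxCount]
    by_cases h1 : b ≤ a
    · simp [Finset.Ico_eq_empty_of_le h1]
    · by_cases h2 : b ≤ a + 1
      · obtain rfl : b = a + 1 := by omega
        have e1 : Nat.ble (a + 1) a = false := by
          rw [← Bool.not_eq_true, Nat.ble_eq]; exact h1
        have e2 : Nat.ble (a + 1) (a + 1) = true := by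
          rw [Nat.ble_eq]
        rw [e1, e2, cond_false, cond_true]
        by_cases hp : a.Prime
        · simp only [aux_test_of_prime hp, cond_true]
          exact (Finset.card_filter_le _ _).trans (by simp)
        · have : (Finset.Ico a (a + 1)).filter Nat.Prime = ∅ := by
            ext q
            simp only [Finset.mem_filter, Finset.mem_Ico, Finset.notMem_empty, iff_false, not_and]
            intro hq
            obtain rfl : q = a := by omega
            exact hp
          rw [this]
          simp
      · have e1 : Nat.ble b a = false := by
          rw [← Bool.not_eq_true, Nat.ble_eq]; exact h1
        have e2 : Nat.ble b (a + 1) = false := by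
          rw [← Bool.not_eq_true, Nat.ble_eq]; exact h2
        rw [e1, e2, cond_false, cond_false]
        have hs : Finset.Ico a b = Finset.Ico a ((a + b) / 2) ∪ Finset.Ico ((a + b) / 2) b :=
          (Finset.Ico_union_Ico_eq_Ico (by omega) (by omega)).symm
        rw [hs, Finset.filter_union]
        exact (Finset.card_union_le _ _).trans (add_le_add (ih _ _) (ih _ _))

theorem aux_primePi_split (x : ℝ) (a b : ℕ) (hx : x < b) (hx0 : 0 ≤ x) :
    primePi x ≤ ((Finset.range a).filter Nat.Prime).card + auxCount 20 a b := by
  have h : ⌊x⌋₊ + 1 ≤ b := (Nat.floor_lt hx0).2 hx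
  have h1 : (Finset.range (⌊x⌋₊ + 1)) ⊆ Finset.range a ∪ Finset.Ico a b := by
    intro q hq
    simp only [Finset.mem_union, Finset.mem_range, Finset.mem_Ico] at *
    omega
  unfold primePi
  calc _ ≤ ((Finset.range a ∪ Finset.Ico a b).filter Nat.Prime).card :=
        Finset.card_le_card (Finset.filter_subset_filter _ h1)
    _ ≤ _ := by
        rw [Finset.filter_union]
        exact (Finset.card_union_le _ _).trans (add_le_add le_rfl (aux_count_le 20 a b))

theorem aux_range_split (a b : ℕ) :
    ((Finset.range b).filter Nat.Prime).card ≤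
      ((Finset.range a).filter Nat.Prime).card + auxCount 20 a b := by
  have h1 : (Finset.range b) ⊆ Finset.range a ∪ Finset.Ico a b := by
    intro q hq
    simp only [Finset.mem_union, Finset.mem_range, Finset.mem_Ico] at *
    omega
  calc _ ≤ ((Finset.range a ∪ Finset.Ico a b).filter Nat.Prime).card :=
        Finset.card_le_card (Finset.filter_subset_filter _ h1)
    _ ≤ _ := by
        rw [Finset.filter_union]
        exact (Finset.card_union_le _ _).trans (add_le_add le_rfl (aux_count_le 20 a b))

theorem aux_log_step {a b : ℝ} (ha : 0 < a) (hab : a ≤ b) :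
    Real.log b ≤ Real.log a + (b * b - a * a) / (2 * a * b) := by
  have hb : 0 < b := by linarith
  have h := Real.self_le_sinh_iff.2 (Real.log_nonneg ((one_le_div ha).2 hab))
  rw [Real.sinh_log (div_pos hb ha), Real.log_div hb.ne' ha.ne'] at h
  have e : (b / a - (b / a)⁻¹) / 2 = (b * b - a * a) / (2 * a * b) := by
    field_simp
  linarith

theorem aux_check_sound (t : List (ℕ × ℕ × ℕ)) (a m l : ℕ) (ha : 1 ≤ a)
    (hm : ((Finset.range a).filter Nat.Prime).card ≤ m)
    (hl : Real.log a ≤ (l : ℝ) / 1000000) (hc : auxCheck (a, m, l) t = true)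
    (x : ℝ) (hax : a ≤ x) (hx : ∃ e ∈ t, x < (e.1 : ℝ)) :
    (primePi x : ℝ) * Real.log x ≤ 1.346 * x := by
  induction t generalizing a m l with
  | nil => simp at hx
  | cons e t ih =>
    obtain ⟨a', m', l'⟩ := e
    simp only [auxCheck, Bool.and_eq_true, Nat.ble_eq] at hc
    obtain ⟨⟨⟨⟨⟨c1, c2⟩, c3⟩, c4⟩, c5⟩, c6⟩ := hc
    have ha0 : (1 : ℝ) ≤ a := by exact_mod_cast ha
    by_cases hx' : x < a'
    · have h1 : primePi x ≤ m' :=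
        (aux_primePi_split x a a' hx' (by linarith)).trans (by omega)
      have h2 : (primePi x : ℝ) ≤ m' := by exact_mod_cast h1
      have h3 := aux_log_sub_le (a := (a : ℝ)) (b := x) (by linarith) (by linarith)
      have h4 : (m' : ℝ) * l ≤ 1346000 * a := by exact_mod_cast c4
      have h5 : (m' : ℝ) ≤ a := by exact_mod_cast c5
      have h6 : 0 ≤ Real.log x := Real.log_nonneg (by linarith)
      have hm0 : (0 : ℝ) ≤ m' := by positivity
      have h7 : (m' : ℝ) * Real.log a ≤ 1.346 * a := by
        have := mul_le_mul_of_nonneg_left hl hm0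
        linarith
      have h8 : (m' : ℝ) * (Real.log x - Real.log a) ≤ x - a := by
        refine le_trans ?_ h3
        have : Real.log a ≤ Real.log x := Real.log_le_log (by linarith) hax
        exact mul_le_mul_of_nonneg_right h5 (by linarith)
      have h9 := mul_le_mul_of_nonneg_right h2 h6
      linarith
    · push Not at hx'
      have haa : (a : ℝ) ≤ a' := by exact_mod_cast (by omega : a ≤ a')
      refine ih a' m' l' (by omega) ((aux_range_split a a').trans (by omega)) ?_ c6
        hx' ?_
      · have h1 := aux_log_step (a := (a : ℝ)) (b := a') (by linarith) haa
        have hsq : a * a ≤ a' * a' := Nat.mul_le_mul (by omega) (by omega)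
        have c3' : (l : ℝ) * (2 * a * a') + 1000000 * (a' * a' - a * a) ≤ l' * (2 * a * a') := by
          have := (Nat.cast_le (α := ℝ)).2 c3
          push_cast [Nat.cast_sub hsq] at this
          exact this
        have hpos : (0 : ℝ) < 2 * a * a' := by
          have : (0 : ℝ) < a' := by linarith
          positivity
        have h2 : ((a' : ℝ) * a' - a * a) / (2 * a * a') ≤ ((l' : ℝ) - l) / 1000000 := by
          rw [div_le_div_iff₀ hpos (by norm_num)]
          linarith
        linarith
      · obtain ⟨e, he, hxe⟩ := hx
        rcases List.mem_cons.1 he with rfl | he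
        · exact absurd hxe (not_lt.2 hx')
        · exact ⟨e, he, hxe⟩

theorem aux_small (x : ℝ) (hx : 2 ≤ x) (hx' : x < 40000) :
    (primePi x : ℝ) * Real.log x ≤ 1.346 * x := by
  refine aux_check_sound auxCert 2 0 693148 (by norm_num) (by decide) ?_ aux_cert_ok x
    (by exact_mod_cast hx) ?_
  · have := Real.log_two_lt_d9
    push_cast
    linarith
  · refine ⟨auxCert.getLast (by decide), List.getLast_mem _, ?_⟩
    have : (auxCert.getLast (by decide)).1 = 40000 := by decide
    rw [this]
    exact_mod_cast hx'

theorem aux_deriv (t : ℝ) (ht : 1 < t) :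
    HasDerivAt (fun t : ℝ => 1.15 * (t / Real.log t ^ 2 + 4 * t / Real.log t ^ 3)
        - 240 / Real.log t)
      (1.15 * (1 / Real.log t ^ 2 + 2 / Real.log t ^ 3 - 12 / Real.log t ^ 4)
        + 240 / (t * Real.log t ^ 2)) t := by
  have ht0 : t ≠ 0 := by linarith
  have hL : Real.log t ≠ 0 := (Real.log_pos ht).ne'
  have hl := Real.hasDerivAt_log ht0
  have h1 := (hasDerivAt_id t).div (hl.pow 2) (pow_ne_zero 2 hL)
  have h2 := ((hasDerivAt_id t).const_mul 4).div (hl.pow 3) (pow_ne_zero 3 hL)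
  have h3 := (hasDerivAt_const t (240 : ℝ)).div hl hL
  have h4 := ((h1.add h2).const_mul 1.15).sub h3
  refine HasDerivAt.congr_deriv (f := fun t : ℝ =>
    1.15 * (t / Real.log t ^ 2 + 4 * t / Real.log t ^ 3) - 240 / Real.log t) h4 ?_
  simp only [id, Pi.pow_apply]
  field_simp
  ring

theorem aux_primePi_eq (x : ℝ) : primePi x = Nat.primeCounting ⌊x⌋₊ := by
  rw [primePi, Nat.primeCounting, Nat.primeCounting', Nat.count_eq_card_filter_range]

theorem aux_integral (x : ℝ) (hx : 404 ≤ x) :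
    ∫ t in (404 : ℝ)..x, Chebyshev.theta t / (t * Real.log t ^ 2) ≤
      1.15 * (x / Real.log x ^ 2 + 4 * x / Real.log x ^ 3) - 240 / Real.log x + 40 := by
  have h6 : 6 ≤ Real.log 404 := by
    have := aux_le_log (q := 404) 6 1 (by norm_num) (by norm_num) (by norm_num)
    simpa using this
  set H : ℝ → ℝ := fun t : ℝ => 1.15 * (t / Real.log t ^ 2 + 4 * t / Real.log t ^ 3)
        - 240 / Real.log t with hH
  set H' : ℝ → ℝ := fun t => 1.15 * (1 / Real.log t ^ 2 + 2 / Real.log t ^ 3 - 12 / Real.log t ^ 4)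
        + 240 / (t * Real.log t ^ 2) with hH'
  have hI : IntervalIntegrable H' MeasureTheory.volume 404 x := by
    refine ContinuousOn.intervalIntegrable fun t ht => ContinuousAt.continuousWithinAt ?_
    rw [Set.uIcc_of_le hx] at ht
    have h1 : t ≠ 0 := by linarith [ht.1]
    have hL : Real.log t ≠ 0 := (Real.log_pos (by linarith [ht.1])).ne'
    have h2 : Real.log t ^ 2 ≠ 0 := pow_ne_zero _ hL
    have h3 : Real.log t ^ 3 ≠ 0 := pow_ne_zero _ hL
    have h4 : Real.log t ^ 4 ≠ 0 := pow_ne_zero _ hL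
    have h5 : t * Real.log t ^ 2 ≠ 0 := mul_ne_zero h1 h2
    fun_prop (disch := assumption)
  have hI0 : IntervalIntegrable (fun t => Chebyshev.theta t / (t * Real.log t ^ 2))
      MeasureTheory.volume 404 x := by
    rw [intervalIntegrable_iff_integrableOn_Icc_of_le hx]
    exact (Chebyshev.integrableOn_theta_div_id_mul_log_sq x).mono_set
      (Set.Icc_subset_Icc_left (by norm_num))
  have hF : ∫ t in (404 : ℝ)..x, H' t = H x - H 404 := by
    refine intervalIntegral.integral_eq_sub_of_hasDerivAt (fun t ht => ?_) hI
    rw [Set.uIcc_of_le hx] at ht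
    exact aux_deriv t (by linarith [ht.1])
  have hle : ∫ t in (404 : ℝ)..x, Chebyshev.theta t / (t * Real.log t ^ 2) ≤
      ∫ t in (404 : ℝ)..x, H' t := by
    refine intervalIntegral.integral_mono_on hx hI0 hI fun t ht => ?_
    have ht0 : (0 : ℝ) < t := by linarith [ht.1]
    have hL6 : 6 ≤ Real.log t := h6.trans (Real.log_le_log (by norm_num) ht.1)
    have hL : 0 < Real.log t := by linarith
    have h1 := aux_theta t ht0.le
    have e : H' t = (1.15 * t + 240) / (t * Real.log t ^ 2) +
        1.15 * (2 * (Real.log t - 6)) / Real.log t ^ 4 := by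
      simp only [hH']
      field_simp
      ring
    rw [e]
    have h2 : 0 ≤ 1.15 * (2 * (Real.log t - 6)) / Real.log t ^ 4 :=
      div_nonneg (by linarith) (by positivity)
    have h3 : Chebyshev.theta t / (t * Real.log t ^ 2) ≤
        (1.15 * t + 240) / (t * Real.log t ^ 2) := by gcongr
    linarith
  have h404 : -40 ≤ H 404 := by
    simp only [hH]
    have h1 : 240 / Real.log 404 ≤ 40 := by
      rw [div_le_iff₀ (by linarith)]
      linarith
    have h2 : 0 ≤ 1.15 * (404 / Real.log 404 ^ 2 + 4 * 404 / Real.log 404 ^ 3) := by positivity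
    linarith
  have : H x = 1.15 * (x / Real.log x ^ 2 + 4 * x / Real.log x ^ 3) - 240 / Real.log x := rfl
  linarith

theorem aux_large (x : ℝ) (hx : 40000 ≤ x) :
    (primePi x : ℝ) * Real.log x ≤ 1.346 * x := by
  have hp := Chebyshev.primeCounting_eq_theta_div_log_add_integral (x := x) (by linarith)
  have hp0 := Chebyshev.primeCounting_eq_theta_div_log_add_integral (x := 404) (by norm_num)
  have hs := aux_small 404 (by norm_num) (by norm_num)
  rw [aux_primePi_eq] at hs ⊢
  have h6 : 6 ≤ Real.log 404 := by
    have := aux_le_log (q := 404) 6 1 (by norm_num) (by norm_num) (by norm_num)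
    simpa using this
  have hii : ∀ y : ℝ, IntervalIntegrable (fun t => Chebyshev.theta t / (t * Real.log t ^ 2))
      MeasureTheory.volume 2 y ∨ y < 2 := by
    intro y
    rcases lt_or_ge y 2 with h | h
    · exact Or.inr h
    · left
      rw [intervalIntegrable_iff_integrableOn_Icc_of_le h]
      exact Chebyshev.integrableOn_theta_div_id_mul_log_sq y
  have i1 := (hii 404).resolve_right (by norm_num)
  have i2 := (hii x).resolve_right (by linarith)
  have hsub := intervalIntegral.integral_interval_sub_left i2 i1
  have hInt := aux_integral x (by linarith)
  have hth := aux_theta x (by linarith)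
  have hth0 : 0 ≤ Chebyshev.theta 404 / Real.log 404 :=
    div_nonneg (Chebyshev.theta_nonneg _) (by linarith)
  generalize (Nat.primeCounting ⌊(404 : ℝ)⌋₊ : ℝ) = P0 at *
  have hpi0 : P0 ≤ 91 := by
    by_contra hcon
    push Not at hcon
    have := mul_le_mul hcon.le h6 (by norm_num) (by linarith)
    linarith
  have hx0 : 0 < x := by linarith
  have hL40 : 10.5 ≤ Real.log 40000 := by
    have := aux_le_log (q := 40000) 21 2 (by norm_num) (by norm_num) (by norm_num)
    norm_num at this ⊢
    linarith
  have hL40' : Real.log 40000 ≤ 10.6 := by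
    have := aux_log_le (q := 40000) 53 5 (by norm_num) (by norm_num) (by norm_num)
    norm_num at this ⊢
    linarith
  have hL := hL40.trans (Real.log_le_log (by norm_num) hx)
  have hLup := aux_log_sub_le (a := 40000) (b := x) (by norm_num) hx0
  have hdiv : Chebyshev.theta x / Real.log x ≤ (1.15 * x + 240) / Real.log x := by
    gcongr
  have hpi : (Nat.primeCounting ⌊x⌋₊ : ℝ) ≤ 1.15 * x / Real.log x +
      1.15 * (x / Real.log x ^ 2 + 4 * x / Real.log x ^ 3) + 131 := by
    rw [add_div] at hdiv
    rw [← hsub] at hInt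
    linarith
  generalize Real.log x = L at *
  have hL0 : 0 < L := by linarith
  have hmul := mul_le_mul_of_nonneg_right hpi hL0.le
  have e : (1.15 * x / L + 1.15 * (x / L ^ 2 + 4 * x / L ^ 3) + 131) * L =
      x * (1.15 * (1 + 1 / L + 4 * (1 / L) ^ 2)) + 131 * L := by
    field_simp
    ring
  rw [e] at hmul
  have hinv : 1 / L ≤ 0.0953 := by
    rw [div_le_iff₀ hL0]
    linarith
  have hinv0 : 0 ≤ 1 / L := by positivity
  have hb : 1.15 * (1 + 1 / L + 4 * (1 / L) ^ 2) ≤ 1.302 := by nlinarith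
  have hb2 := mul_le_mul_of_nonneg_left hb hx0.le
  linarith

theorem prime_counting_chebyshev_bound (x : ℝ) (hx : 2 ≤ x) :
    (primePi x : ℝ) ≤ (1 + Real.log 2 / 2) * x / Real.log x := by
  have hL : 0 < Real.log x := Real.log_pos (by linarith)
  rw [le_div_iff₀ hL]
  have h : (primePi x : ℝ) * Real.log x ≤ 1.346 * x := by
    rcases lt_or_ge x 40000 with h | h
    · exact aux_small x hx h
    · exact aux_large x h
  have h2 := Real.log_two_gt_d9
  have : 1.346 * x ≤ (1 + Real.log 2 / 2) * x := by
    apply mul_le_mul_of_nonneg_right _ (by linarith)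
    linarith
  linarith
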